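/- Let φ > 0 and consider the time-dependent Hamiltonian on (ℝ²∖{0}) × ℝ² given by H(s, q, p) = (1/2)|p − a(s, q)|², where a(s, q) = (1/2 − φ s/|q|²) q^⊥ and q^⊥ = (−q₂, q₁). Let (q, p) : I → (ℝ²∖{0}) × ℝ² be a differentiable solution of Hamilton's equations q′(s) = ∇_p H(s, q(s), p(s)), p′(s) = −∇_q H(s, q(s), p(s)) on an open interval I. Define the velocity v(s) = p(s) − a(s, q(s)), the center c(s) = q(s) − v(s)^⊥, and the energy E(s) = (1/2)|v(s)|². Then there exists a constant s₀ ∈ ℝ such that (1/2)|c(s)|² = E(s) + φ(s − s₀) for all s ∈ I; equivalently, the derivative of (1/2)|c(s)|² − E(s) with respect to s is identically equal to φ. -/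

import Mathlib

open MeasureTheory Filter Topology

noncomputable section

/-- The plane `ℝ²` with its Euclidean inner product structure. -/
abbrev Plane : Type := EuclideanSpace ℝ (Fin 2)

/-- Rotation by `π/2`: `q^⊥ = (-q₂, q₁)`. -/
def perp (q : Plane) : Plane := !₂[-(q 1), q 0]

/-- The time-dependent vector potential `a(s,q) = (1/2 - φ s / |q|²) q^⊥`. -/
def vecPot (φ s : ℝ) (q : Plane) : Plane := ((1 : ℝ)/2 - φ * s / ‖q‖^2) • perp q

/-- The time-dependent Hamiltonian `H(s,q,p) = (1/2)|p - a(s,q)|²`. -/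
def Ham (φ s : ℝ) (q p : Plane) : ℝ := (1/2) * ‖p - vecPot φ s q‖^2

/-- Hamilton's equations `q' = ∇_p H`, `p' = -∇_q H` hold at time `s`. -/
def HamiltonEqnsAt (φ : ℝ) (q p : ℝ → Plane) (s : ℝ) : Prop :=
  HasDerivAt q (gradient (fun y => Ham φ s (q s) y) (p s)) s ∧
    HasDerivAt p (-(gradient (fun x => Ham φ s x (p s)) (q s))) s

theorem Ham_coord (φ s : ℝ) (x y : Plane) :
    Ham φ s x y = (1/2) * ((y 0 + (1/2 - φ * s / (x 0 ^ 2 + x 1 ^ 2)) * x 1) ^ 2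
      + (y 1 - (1/2 - φ * s / (x 0 ^ 2 + x 1 ^ 2)) * x 0) ^ 2) := by
  simp only [Ham, vecPot, perp, EuclideanSpace.norm_sq_eq, Fin.sum_univ_two, Real.norm_eq_abs,
    sq_abs]
  simp

theorem normsq_pos_of_ne (x : Plane) (hx : x ≠ 0) : 0 < x 0 ^ 2 + x 1 ^ 2 := by
  have h : 0 < ‖x‖ ^ 2 := by positivity
  simpa [EuclideanSpace.norm_sq_eq, Fin.sum_univ_two] using h

theorem inner_grad_line (f : Plane → ℝ) (x w : Plane) (hf : DifferentiableAt ℝ f x) (d : ℝ)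
    (hd : HasDerivAt (fun t : ℝ => f (x + t • w)) d 0) :
    gradient f x 0 * w 0 + gradient f x 1 * w 1 = d := by
  have h1 : inner ℝ (gradient f x) w = fderiv ℝ f x w := by
    simp [gradient]
  have h2 : HasLineDerivAt ℝ f (fderiv ℝ f x w) x w := hf.hasFDerivAt.hasLineDerivAt w
  have h3 := HasDerivAt.unique h2 hd
  rw [← h3, ← h1, PiLp.inner_apply, Fin.sum_univ_two]
  simp only [RCLike.inner_apply, conj_trivial]
  ring

theorem grad_p_perp (φ s : ℝ) (x y : Plane) :
    gradient (fun y => Ham φ s x y) y 0 * (-(y 1)) + gradient (fun y => Ham φ s x y) y 1 * y 0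
      = -((1/2 - φ * s / (x 0 ^ 2 + x 1 ^ 2)) * (x 0 * y 0 + x 1 * y 1)) := by
  have := inner_grad_line (fun y => Ham φ s x y) y (perp y) (by
    simp only [Ham_coord]
    fun_prop) (-((1/2 - φ * s / (x 0 ^ 2 + x 1 ^ 2)) * (x 0 * y 0 + x 1 * y 1))) (by
    simp only [Ham_coord]
    generalize (1/2 - φ * s / (x 0 ^ 2 + x 1 ^ 2)) = k
    simp only [perp, PiLp.add_apply, PiLp.smul_apply, smul_eq_mul]
    simp only [PiLp.toLp_apply, Matrix.cons_val_zero, Matrix.cons_val_one]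
    have e0 : HasDerivAt (fun t : ℝ => y 0 + t * (-(y 1)) + k * x 1) (-(y 1)) 0 := by
      simpa using (((hasDerivAt_id (0:ℝ)).mul_const (-(y 1))).const_add (y 0)).add_const (k * x 1)
    have e1 : HasDerivAt (fun t : ℝ => y 1 + t * (y 0) - k * x 0) (y 0) 0 := by
      simpa using (((hasDerivAt_id (0:ℝ)).mul_const (y 0)).const_add (y 1)).sub_const (k * x 0)
    refine (((e0.pow 2).add (e1.pow 2)).const_mul (1/2 : ℝ)).congr_deriv ?_
    norm_num
    ring)
  simpa [perp] using this

theorem grad_q_perp (φ s : ℝ) (x y : Plane) (hx : x ≠ 0) :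
    gradient (fun x => Ham φ s x y) x 0 * (-(x 1)) + gradient (fun x => Ham φ s x y) x 1 * x 0
      = ((1/2 - φ * s / (x 0 ^ 2 + x 1 ^ 2)) * (x 0 * y 0 + x 1 * y 1)) := by
  have hpos := normsq_pos_of_ne x hx
  have := inner_grad_line (fun x => Ham φ s x y) x (perp x) (by
    simp only [Ham_coord]
    have hne := hpos.ne'
    fun_prop (disch := assumption))
    ((1/2 - φ * s / (x 0 ^ 2 + x 1 ^ 2)) * (x 0 * y 0 + x 1 * y 1)) (by
    simp only [Ham_coord]
    simp only [perp, PiLp.add_apply, PiLp.smul_apply, smul_eq_mul]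
    simp only [PiLp.toLp_apply, Matrix.cons_val_zero, Matrix.cons_val_one]
    have e0 : HasDerivAt (fun t : ℝ => x 0 + t * (-(x 1))) (-(x 1)) 0 := by
      simpa using (((hasDerivAt_id (0:ℝ)).mul_const (-(x 1))).const_add (x 0))
    have e1 : HasDerivAt (fun t : ℝ => x 1 + t * (x 0)) (x 0) 0 := by
      simpa using (((hasDerivAt_id (0:ℝ)).mul_const (x 0)).const_add (x 1))
    have er : HasDerivAt (fun t : ℝ => (x 0 + t * (-(x 1))) ^ 2 + (x 1 + t * (x 0)) ^ 2) 0 0 := by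
      refine ((e0.pow 2).add (e1.pow 2)).congr_deriv ?_
      norm_num
      ring
    have ek : HasDerivAt (fun t : ℝ => 1/2 - φ * s /
        ((x 0 + t * (-(x 1))) ^ 2 + (x 1 + t * (x 0)) ^ 2)) 0 0 := by
      have := ((hasDerivAt_const (0:ℝ) (φ * s)).div er (by simpa using hpos.ne')).const_sub (1/2)
      simpa using this
    refine (((((ek.mul e1).const_add (y 0)).pow 2).add
      (((ek.mul e0).const_sub (y 1)).pow 2)).const_mul (1/2 : ℝ)).congr_deriv ?_
    norm_num
    ring)
  simpa [perp] using this

theorem hasDerivAt_coord (q : ℝ → Plane) (d : Plane) (s : ℝ) (h : HasDerivAt q d s) (i : Fin 2) :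
    HasDerivAt (fun t => q t i) (d i) s :=
  ((EuclideanSpace.proj  i : Plane →L[ℝ] ℝ).hasFDerivAt.comp_hasDerivAt s h)

/-- Along any solution of Hamilton's equations on an open interval
`(a,b)`, with velocity `v = p - a(s,q)`, center `c = q - v^⊥` and energy
`E = |v|²/2`, one has `|c(s)|²/2 = E(s) + φ (s - s₀)` for some constant `s₀`. -/
theorem center_energy_relation (φ : ℝ) (hφ : 0 < φ) (a b : ℝ)
    (q p : ℝ → Plane)
    (hq0 : ∀ s ∈ Set.Ioo a b, q s ≠ 0)
    (hham : ∀ s ∈ Set.Ioo a b, HamiltonEqnsAt φ q p s)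
    (v c : ℝ → Plane) (E : ℝ → ℝ)
    (hv : ∀ s, v s = p s - vecPot φ s (q s))
    (hc : ∀ s, c s = q s - perp (v s))
    (hE : ∀ s, E s = (1/2) * ‖v s‖^2) :
    ∃ s₀ : ℝ, ∀ s ∈ Set.Ioo a b, (1/2) * ‖c s‖^2 = E s + φ * (s - s₀) := by
  have key : ∀ s ∈ Set.Ioo a b, (1/2) * ‖c s‖^2 - E s = q s 0 * p s 1 - q s 1 * p s 0 + φ * s := by
    intro s hs
    have hpos := (normsq_pos_of_ne _ (hq0 s hs)).ne'
    rw [hE, hc, hv]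
    simp only [vecPot, perp, EuclideanSpace.norm_sq_eq, Fin.sum_univ_two, Real.norm_eq_abs, sq_abs]
    simp
    field_simp
    ring
  have hd : ∀ s ∈ Set.Ioo a b, HasDerivAt (fun s => q s 0 * p s 1 - q s 1 * p s 0) 0 s := by
    intro s hs
    obtain ⟨h1, h2⟩ := hham s hs
    have g1 := grad_p_perp φ s (q s) (p s)
    have g2 := grad_q_perp φ s (q s) (p s) (hq0 s hs)
    have := ((hasDerivAt_coord q _ s h1 0).mul (hasDerivAt_coord p _ s h2 1)).sub
      ((hasDerivAt_coord q _ s h1 1).mul (hasDerivAt_coord p _ s h2 0))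
    refine this.congr_deriv ?_
    simp only [PiLp.neg_apply]
    linarith
  rcases (Set.Ioo a b).eq_empty_or_nonempty with he | ⟨m, hm⟩
  · exact ⟨0, by simp [he]⟩
  · refine ⟨-(q m 0 * p m 1 - q m 1 * p m 0) / φ, fun s hs => ?_⟩
    have hconst : q s 0 * p s 1 - q s 1 * p s 0 = q m 0 * p m 1 - q m 1 * p m 0 :=
      isOpen_Ioo.is_const_of_deriv_eq_zero isPreconnected_Ioo
        (f := fun s => q s 0 * p s 1 - q s 1 * p s 0)
        (fun x hx => (hd x hx).differentiableAt.differentiableWithinAt)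
        (fun x hx => (hd x hx).deriv) hs hm
    have hk := key s hs
    have : φ * (s - -(q m 0 * p m 1 - q m 1 * p m 0) / φ)
        = φ * s + (q m 0 * p m 1 - q m 1 * p m 0) := by
      field_simp
      ring
    rw [this]
    linarith
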